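/- Let U ⊂ R^n be open containing the closed unit ball and f : U → R^n a weakly (1+ε)-quasisymmetric homeomorphism onto its image with 0 ≤ ε ≤ 1/20 and f(±e_1) = ±e_1. Then f(B(0,1)) ⊇ B(f(0), 5/6) and the local flatness θ_{f(L)}(f(0), 1/2) ≤ 20ε, where L = e_1^⊥. -/

import Mathlib

open RealInnerProductSpace Pointwise

/-- The local flatness `θ_Σ(x,r)`: `(1/r)` times the infimum over hyperplanes `L`
(that is, `(n-1)`-dimensional linear subspaces) of the Hausdorff distance between
`Σ ∩ B(x,r)` and `(x + L) ∩ B(x,r)`. -/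
noncomputable def localFlatness {n : ℕ} (S : Set (EuclideanSpace ℝ (Fin n)))
    (x : EuclideanSpace ℝ (Fin n)) (r : ℝ) : ℝ :=
  (1/r) * sInf {d : ℝ | ∃ L : Submodule ℝ (EuclideanSpace ℝ (Fin n)),
    Module.finrank ℝ L = n - 1 ∧
    d = Metric.hausdorffDist (S ∩ Metric.closedBall x r)
          ((x +ᵥ (L : Set (EuclideanSpace ℝ (Fin n)))) ∩ Metric.closedBall x r)}


open Set Metric MeasureTheory in
theorem subset_image_ball_of_disjoint_image_sphere {X Y : Type*} [PseudoMetricSpace X]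
    [ProperSpace X] [TopologicalSpace Y] [T2Space Y] {f : X → Y} {x : X} {r : ℝ} {V : Set Y}
    (hf : ContinuousOn f (closedBall x r)) (hopen : IsOpen (f '' ball x r))
    (hV : IsPreconnected V) (hne : (V ∩ f '' ball x r).Nonempty)
    (hdisj : Disjoint V (f '' sphere x r)) : V ⊆ f '' ball x r := by
  have hcl : IsClosed (f '' closedBall x r) :=
    ((isCompact_closedBall x r).image_of_continuousOn hf).isClosed
  have hcover : V ⊆ f '' ball x r ∪ (f '' closedBall x r)ᶜ := by
    intro y hy
    by_cases h : y ∈ f '' closedBall x r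
    · rw [← ball_union_sphere, image_union] at h
      exact .inl (h.resolve_right fun h' => disjoint_left.1 hdisj hy h')
    · exact .inr h
  refine hV.subset_left_of_subset_union hopen hcl.isOpen_compl ?_ hcover hne
  exact disjoint_compl_right.mono_left (image_mono ball_subset_closedBall)

theorem det_one_add_eq_sum_lagrange {E : Type*} [NormedAddCommGroup E] [NormedSpace ℝ E]
    [FiniteDimensional ℝ E] (s : Finset ℝ) (hs : Module.finrank ℝ E < s.card) (A : E →L[ℝ] E) :
    (1 + A).det = ∑ t ∈ s, (1 + t • A).det * (Lagrange.basis s id t).eval 1 := by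
  classical
  let b := Module.finBasis ℝ E
  let M := LinearMap.toMatrix b b (A : E →ₗ[ℝ] E)
  let p : Polynomial ℝ := Matrix.det ((Polynomial.X : Polynomial ℝ) • M.map Polynomial.C +
    (1 : Matrix _ _ ℝ).map Polynomial.C)
  have hp : ∀ t : ℝ, p.eval t = (1 + t • A).det := by
    intro t
    have h1 : p.eval t = Matrix.det (1 + t • M) := by
      rw [← Polynomial.coe_evalRingHom, RingHom.map_det]
      congr 1
      ext i j
      simp only [RingHom.mapMatrix_apply, Matrix.map_apply, Matrix.add_apply, Matrix.smul_apply,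
        smul_eq_mul, Polynomial.coe_evalRingHom, Polynomial.eval_add, Polynomial.eval_mul,
        Polynomial.eval_X, Polynomial.eval_C]
      exact add_comm _ _
    rw [h1, ContinuousLinearMap.det, ← LinearMap.det_toMatrix b]
    congr 1
    simp [M]
  have hdeg : p.degree < s.card := by
    refine (Polynomial.degree_le_natDegree).trans_lt ?_
    exact_mod_cast (Polynomial.natDegree_det_X_add_C_le M 1).trans_lt (by simpa using hs)
  have := congrArg (Polynomial.eval 1) (Lagrange.eq_interpolate (v := id) (by simp) hdeg)
  rw [hp, one_smul] at this
  rw [this, Lagrange.interpolate_apply, Polynomial.eval_finsetSum]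
  simp [hp]

open Set Metric in
theorem image_ball_eq_ball_of_lipschitz_perturbation {E : Type*} [NormedAddCommGroup E]
    [NormedSpace ℝ E] [FiniteDimensional ℝ E] {r : E → E} {K : NNReal}
    (hr : ∀ x, ‖x‖ ≤ 1 → ‖r x‖ ≤ 1) (hfix : ∀ x, ‖x‖ = 1 → r x = x)
    (hK : LipschitzOnWith K (fun x => r x - x) (closedBall 0 1)) {t : ℝ}
    (ht0 : 0 ≤ t) (ht1 : t < 1) (htK : t * K < 1) :
    InjOn (fun x => x + t • (r x - x)) (ball 0 1) ∧
      (fun x => x + t • (r x - x)) '' ball 0 1 = ball 0 1 := by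
  lift t to NNReal using ht0
  have happ : ApproximatesLinearOn (fun x => x + (t : ℝ) • (r x - x))
      (ContinuousLinearEquiv.refl ℝ E : E →L[ℝ] E) (ball 0 1) (t * K) := by
    intro x hx y hy
    have h := hK.norm_sub_le (ball_subset_closedBall hx) (ball_subset_closedBall hy)
    have : x + (t : ℝ) • (r x - x) - (y + (t : ℝ) • (r y - y)) -
        ((ContinuousLinearEquiv.refl ℝ E : E →L[ℝ] E) (x - y)) =
        (t : ℝ) • ((r x - x) - (r y - y)) := by
      simp [smul_sub]; abel
    rw [this, norm_smul, NNReal.coe_mul, mul_assoc]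
    simpa using mul_le_mul_of_nonneg_left h t.2
  have hc : Subsingleton E ∨
      t * K < ‖((ContinuousLinearEquiv.refl ℝ E).symm : E →L[ℝ] E)‖₊⁻¹ := by
    rcases subsingleton_or_nontrivial E with h | h
    · exact .inl h
    · right
      simp only [ContinuousLinearEquiv.refl_symm, ContinuousLinearEquiv.coe_refl,
        ContinuousLinearMap.nnnorm_id, inv_one]
      exact_mod_cast htK
  have hopen : IsOpen ((fun x => x + (t : ℝ) • (r x - x)) '' ball 0 1) :=
    (happ.toOpenPartialHomeomorph _ _ hc isOpen_ball).open_target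
  have hcont : ContinuousOn (fun x => x + (t : ℝ) • (r x - x)) (closedBall 0 1) :=
    continuousOn_id.add (hK.continuousOn.const_smul _)
  have hmaps : (fun x => x + (t : ℝ) • (r x - x)) '' ball 0 1 ⊆ ball 0 1 := by
    rintro _ ⟨x, hx, rfl⟩
    rw [mem_ball_zero_iff] at hx ⊢
    have : x + (t : ℝ) • (r x - x) = (1 - t : ℝ) • x + (t : ℝ) • r x := by module
    calc ‖x + (t : ℝ) • (r x - x)‖ ≤ ‖(1 - t : ℝ) • x‖ + ‖(t : ℝ) • r x‖ := by
          rw [this]; exact norm_add_le _ _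
      _ = (1 - t) * ‖x‖ + t * ‖r x‖ := by
          rw [norm_smul, norm_smul, Real.norm_of_nonneg (by linarith), NNReal.norm_eq]
      _ < 1 := by nlinarith [hr x hx.le, t.2]
  refine ⟨happ.injOn hc, hmaps.antisymm ?_⟩
  refine subset_image_ball_of_disjoint_image_sphere hcont hopen
    (convex_ball (0 : E) 1).isPreconnected ?_ ?_
  · refine ⟨_, hmaps ⟨0, by simp, rfl⟩, ⟨0, by simp, rfl⟩⟩
  · rw [disjoint_left]
    rintro _ hy ⟨x, hx, rfl⟩
    rw [mem_sphere_zero_iff_norm] at hx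
    simp [hfix x hx, hx] at hy

theorem det_eq_zero_of_norm_eventually_eq_one {E : Type*} [NormedAddCommGroup E]
    [InnerProductSpace ℝ E] [FiniteDimensional ℝ E] {r : E → E} {r' : E →L[ℝ] E} {x : E}
    (hr' : HasFDerivAt r r' x) (hr : ∀ᶠ y in nhds x, ‖r y‖ = 1) : r'.det = 0 := by
  by_contra hdet
  have h1 : HasFDerivAt (fun y => ⟪r y, r y⟫) (0 : E →L[ℝ] ℝ) x := by
    refine (hasFDerivAt_const (1 : ℝ) x).congr_of_eventuallyEq ?_
    filter_upwards [hr] with y hy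
    rw [real_inner_self_eq_norm_sq, hy, one_pow]
  have h2 := (hr'.inner ℝ hr').unique h1
  have hsurj : Function.Surjective r' := by
    intro y
    exact (LinearMap.equivOfDetNeZero (r' : E →ₗ[ℝ] E) hdet).surjective y
  obtain ⟨v, hv⟩ := hsurj (r x)
  have h3 := congrArg (fun L : E →L[ℝ] ℝ => L v) h2
  have h4 := hr.self_of_nhds
  simp [hv, h4] at h3

open Set Metric MeasureTheory in
theorem not_exists_contDiff_retraction_sphere {E : Type*} [NormedAddCommGroup E]
    [InnerProductSpace ℝ E] [FiniteDimensional ℝ E] {r : E → E} (hr : ContDiff ℝ 1 r)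
    (hnorm : ∀ x, ‖x‖ ≤ 1 → ‖r x‖ = 1) (hfix : ∀ x, ‖x‖ = 1 → r x = x) : False := by
  borelize E
  let μ : Measure E := Measure.addHaar
  let D : E → E →L[ℝ] E := fun x => fderiv ℝ r x - 1
  have hDcont : Continuous D := (hr.continuous_fderiv one_ne_zero).sub continuous_const
  have hDderiv : ∀ x, HasFDerivAt (fun x => r x - x) (D x) x := fun x =>
    ((hr.differentiable one_ne_zero) x).hasFDerivAt.sub (hasFDerivAt_id x)
  obtain ⟨K, hKpos, hK⟩ : ∃ K : NNReal, 0 < K ∧ ∀ x ∈ closedBall (0 : E) 1, ‖D x‖₊ ≤ K := by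
    obtain ⟨C, hC⟩ := (isCompact_closedBall (0 : E) 1).exists_bound_of_continuousOn
      hDcont.continuousOn
    refine ⟨C.toNNReal + 1, by positivity, fun x hx => ?_⟩
    exact_mod_cast (hC x hx).trans ((Real.le_coe_toNNReal C).trans (by simp))
  have hLip : LipschitzOnWith K (fun x => r x - x) (closedBall 0 1) :=
    (convex_closedBall (0 : E) 1).lipschitzOnWith_of_nnnorm_hasFDerivWithin_le
      (fun x _ => (hDderiv x).hasFDerivWithinAt) hK
  obtain ⟨δ, hδ, hdet⟩ : ∃ δ > 0, ∀ A : E →L[ℝ] E, ‖A‖ < δ → 0 < (1 + A).det := by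
    have hc : Continuous fun A : E →L[ℝ] E => (1 + A).det :=
      ContinuousLinearMap.continuous_det.comp (continuous_const.add continuous_id)
    have h0 : (0 : ℝ) < (1 + (0 : E →L[ℝ] E)).det := by
      simp [ContinuousLinearMap.det]
    obtain ⟨δ, hδ, h⟩ := Metric.eventually_nhds_iff.1 (hc.continuousAt.eventually_const_lt h0)
    exact ⟨δ, hδ, fun A hA => h (by simpa using hA)⟩
  obtain ⟨τ, hτ0, hτ1, hτK, hτδ⟩ : ∃ τ : ℝ, 0 < τ ∧ τ ≤ 1 ∧ τ * K ≤ 1 ∧ τ * K ≤ δ := by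
    have hK' : (0 : ℝ) < K := hKpos
    refine ⟨min 1 (min 1 δ / K), by positivity, min_le_left _ _, ?_, ?_⟩ <;>
    · refine (mul_le_mul_of_nonneg_right (min_le_right _ _) hK'.le).trans ?_
      rw [div_mul_cancel₀ _ hK'.ne']
      simp
  have hvol : ∀ t ∈ Ioo 0 τ, ∫ x in ball 0 1, (1 + t • D x).det ∂μ = μ.real (ball 0 1) := by
    rintro t ⟨ht0, htτ⟩
    have hK' : (0 : ℝ) < K := hKpos
    have htK : t * K < τ * K := mul_lt_mul_of_pos_right htτ hK'
    obtain ⟨hinj, himg⟩ := image_ball_eq_ball_of_lipschitz_perturbation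
      (fun x hx => (hnorm x hx).le) hfix hLip ht0.le (htτ.trans_le hτ1) (htK.trans_le hτK)
    have h := integral_image_eq_integral_abs_det_fderiv_smul μ (f' := fun x => 1 + t • D x)
      measurableSet_ball
      (fun x _ => ((hasFDerivAt_id x).add ((hDderiv x).const_smul t)).hasFDerivWithinAt)
      hinj (fun _ => (1 : ℝ))
    change ∫ _ in (fun x => x + t • (r x - x)) '' ball 0 1, (1 : ℝ) ∂μ = _ at h
    rw [himg] at h
    simp only [integral_const, smul_eq_mul, mul_one, measureReal_restrict_apply_univ] at h
    rw [h]
    refine setIntegral_congr_fun measurableSet_ball fun x hx => (abs_of_pos (hdet _ ?_)).symm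
    have hx' : ‖D x‖ ≤ K := hK x (ball_subset_closedBall hx)
    rw [norm_smul, Real.norm_of_nonneg ht0.le]
    nlinarith
  obtain ⟨s, hsub, hcard⟩ := (Ioo_infinite hτ0).exists_subset_card_eq (Module.finrank ℝ E + 1)
  have hsum : ∑ t ∈ s, (Lagrange.basis s id t).eval 1 = 1 := by
    rw [← Polynomial.eval_finsetSum, Lagrange.sum_basis (by simp)
      (Finset.card_pos.1 (by omega)), Polynomial.eval_one]
  have hcontdet : ∀ t : ℝ, Continuous fun x => (1 + t • D x).det := fun t =>
    ContinuousLinearMap.continuous_det.comp (continuous_const.add (hDcont.const_smul t))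
  have hone : ∫ x in ball 0 1, (1 + D x).det ∂μ = μ.real (ball 0 1) := by
    simp_rw [fun x => det_one_add_eq_sum_lagrange s (by omega) (D x)]
    rw [integral_finsetSum]
    · simp_rw [integral_mul_const]
      rw [Finset.sum_congr rfl fun t ht => by rw [hvol t (hsub ht)], ← Finset.mul_sum, hsum,
        mul_one]
    · intro t _
      refine Integrable.mul_const ?_ _
      exact ((hcontdet t).continuousOn.integrableOn_compact
        (isCompact_closedBall (0 : E) 1)).mono_set ball_subset_closedBall
  have hzero : ∫ x in ball 0 1, (1 + D x).det ∂μ = 0 := by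
    refine setIntegral_eq_zero_of_forall_eq_zero fun x hx => ?_
    have : 1 + D x = fderiv ℝ r x := by simp [D]
    rw [this]
    refine det_eq_zero_of_norm_eventually_eq_one
      ((hr.differentiable one_ne_zero) x).hasFDerivAt ?_
    filter_upwards [isOpen_ball.mem_nhds hx] with y hy
    exact hnorm y (mem_closedBall_zero_iff.1 (ball_subset_closedBall hy))
  have hpos : 0 < μ.real (ball (0 : E) 1) :=
    ENNReal.toReal_pos (measure_ball_pos μ 0 one_pos).ne' measure_ball_lt_top.ne
  linarith [hone.symm.trans hzero]

open Set Metric in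
theorem exists_zero_of_norm_sub_le_one {E : Type*} [NormedAddCommGroup E]
    [InnerProductSpace ℝ E] [FiniteDimensional ℝ E] {F : E → E}
    (hF : ContinuousOn F (closedBall 0 1)) (hle : ∀ x ∈ closedBall (0 : E) 1, ‖F x - x‖ ≤ 1) :
    ∃ x ∈ closedBall (0 : E) 1, F x = 0 := by
  by_contra! hne
  let P : E → E := fun x => (max 1 ‖x‖)⁻¹ • x
  let a : E → ℝ := fun x => max 0 (min 1 (2 - ‖x‖))
  let H : E → E := fun x => a x • F (P x) + (1 - a x) • x
  have hmax : ∀ x : E, 0 < max 1 ‖x‖ := fun x => lt_of_lt_of_le one_pos (le_max_left _ _)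
  have hPmem : ∀ x, P x ∈ closedBall (0 : E) 1 := by
    intro x
    rw [mem_closedBall_zero_iff, norm_smul, norm_inv, Real.norm_of_nonneg (hmax x).le,
      inv_mul_le_iff₀ (hmax x), mul_one]
    exact le_max_right _ _
  have hPcont : Continuous P :=
    ((continuous_const.max continuous_norm).inv₀ fun x => (hmax x).ne').smul continuous_id
  have hacont : Continuous a := by fun_prop
  have hHcont : Continuous H :=
    (hacont.smul (hF.comp_continuous hPcont hPmem)).add
      ((continuous_const.sub hacont).smul continuous_id)
  have hHid : ∀ x, 2 ≤ ‖x‖ → H x = x := by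
    intro x hx
    have : a x = 0 := max_eq_left ((min_le_right _ _).trans (by linarith))
    simp [H, this]
  have hHne : ∀ x, H x ≠ 0 := by
    intro x hx
    rcases le_or_gt ‖x‖ 1 with h1 | h1
    · have ha : a x = 1 := by
        simp only [a]
        rw [min_eq_left (by linarith), max_eq_right zero_le_one]
      have hP : P x = x := by simp [P, max_eq_left h1]
      exact hne x (mem_closedBall_zero_iff.2 h1) (by simpa [H, ha, hP] using hx)
    · have ha0 : 0 ≤ a x := le_max_left _ _
      have ha1 : a x < 1 := max_lt one_pos ((min_le_right _ _).trans_lt (by linarith))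
      have hxP : x = ‖x‖ • P x := by
        simp only [P]
        rw [max_eq_right h1.le, smul_inv_smul₀ (by linarith)]
      have hPn : ‖P x‖ = 1 := by
        have := congrArg norm hxP
        rw [norm_smul, norm_norm] at this
        nlinarith
      have hinner : 0 ≤ ⟪F (P x), P x⟫ := by
        have h2 : ⟪F (P x), P x⟫ = ⟪F (P x) - P x, P x⟫ + 1 := by
          rw [inner_sub_left, real_inner_self_eq_norm_sq, hPn]; ring
        have h3 := abs_real_inner_le_norm (F (P x) - P x) (P x)
        rw [hPn, mul_one] at h3
        linarith [(abs_le.1 (h3.trans (hle _ (hPmem x)))).1]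
      have h4 : ⟪H x, P x⟫ = a x * ⟪F (P x), P x⟫ + (1 - a x) * ‖x‖ := by
        have h5 : ⟪x, P x⟫ = ‖x‖ := by
          calc ⟪x, P x⟫ = ⟪‖x‖ • P x, P x⟫ := by rw [← hxP]
            _ = ‖x‖ := by
              rw [real_inner_smul_left, real_inner_self_eq_norm_sq, hPn]; ring
        simp only [H]
        rw [inner_add_left, real_inner_smul_left, real_inner_smul_left, h5]
      rw [hx, inner_zero_left] at h4
      nlinarith [mul_nonneg ha0 hinner]
  obtain ⟨G, hG, hGH, hGeq, -⟩ := hHcont.exists_contDiff_approx_and_eqOn 1 hHcont.norm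
    (fun x => norm_pos_iff.2 (hHne x)) (S := {x : E | 3 ≤ ‖x‖}) (U := {x : E | 2 < ‖x‖})
    (isClosed_le continuous_const continuous_norm)
    ((isOpen_lt continuous_const continuous_norm).mem_nhdsSet.2 fun x (hx : 3 ≤ ‖x‖) =>
      show 2 < ‖x‖ by linarith)
    (contDiffOn_id.congr fun x hx => hHid x (le_of_lt hx))
  have hGne : ∀ x, G x ≠ 0 := by
    intro x hx
    have := hGH x
    simp [hx] at this
  refine not_exists_contDiff_retraction_sphere (r := fun x : E => ‖G ((3 : ℝ) • x)‖⁻¹ • G ((3 : ℝ) • x))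
    ?_ ?_ ?_
  · have hG3 : ContDiff ℝ 1 fun x : E => G ((3 : ℝ) • x) := hG.comp (contDiff_const_smul _)
    exact ((hG3.norm ℝ fun x => hGne _).inv fun x => norm_ne_zero_iff.2 (hGne _)).smul hG3
  · intro x _
    rw [norm_smul, norm_inv, norm_norm, inv_mul_cancel₀ (norm_ne_zero_iff.2 (hGne _))]
  · intro x hx
    have h3 : ‖(3 : ℝ) • x‖ = 3 := by simp [norm_smul, hx]
    rw [hGeq (show 3 ≤ ‖(3 : ℝ) • x‖ from h3.ge), hHid _ (by rw [h3]; norm_num), h3,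
      inv_smul_smul₀ (by norm_num)]

open Set Metric MeasureTheory in
theorem image_closedBall_mem_nhds_of_injOn {E : Type*} [NormedAddCommGroup E]
    [InnerProductSpace ℝ E] [FiniteDimensional ℝ E] {f : E → E}
    (hf : ContinuousOn f (closedBall 0 1)) (hinj : InjOn f (closedBall 0 1)) :
    f '' closedBall 0 1 ∈ nhds (f 0) := by
  borelize E
  let μ : Measure E := Measure.addHaar
  have h0mem : (0 : E) ∈ closedBall (0 : E) 1 := by simp
  obtain ⟨G, hG⟩ : ∃ G : C(E, E), ∀ x ∈ closedBall (0 : E) 1, G (f x) = x := by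
    have : CompactSpace (closedBall (0 : E) 1) :=
      isCompact_iff_compactSpace.1 (isCompact_closedBall 0 1)
    have hemb : Topology.IsClosedEmbedding ((closedBall (0 : E) 1).domRestrict f) :=
      hf.domRestrict.isClosedEmbedding (injOn_iff_injective.1 hinj)
    obtain ⟨G, hG⟩ := ContinuousMap.exists_extension hemb
      (⟨Subtype.val, continuous_subtype_val⟩ : C(closedBall (0 : E) 1, E))
    exact ⟨G, fun x hx => DFunLike.congr_fun hG ⟨x, hx⟩⟩
  by_contra hnot
  obtain ⟨δ, hδ, hGδ⟩ : ∃ δ > 0, ∀ y, dist y (f 0) < 2 * δ → ‖G y‖ < 1 / 4 := by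
    have h : ∀ᶠ y in nhds (f 0), ‖G y‖ < 1 / 4 :=
      G.continuous.norm.continuousAt.eventually_lt_const (by simp [hG 0 h0mem])
    obtain ⟨ρ, hρ, h⟩ := Metric.eventually_nhds_iff.1 h
    exact ⟨ρ / 2, by positivity, fun y hy => h (by linarith)⟩
  obtain ⟨c, hcδ, hcK⟩ : ∃ c, dist c (f 0) < δ ∧ c ∉ f '' closedBall 0 1 := by
    by_contra! h
    exact hnot (Metric.mem_nhds_iff.2 ⟨δ, hδ, h⟩)
  obtain ⟨η, hη, hη4, hGη⟩ : ∃ η > 0, η ≤ 1 / 4 ∧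
      ∀ x ∈ closedBall (0 : E) 1, δ ≤ dist (f x) c → 2 * η ≤ ‖x‖ := by
    have hx0 : ∀ᶠ x in nhdsWithin 0 (closedBall (0 : E) 1), dist (f x) c < δ :=
      (Filter.Tendsto.dist (hf 0 h0mem) tendsto_const_nhds).eventually_lt_const (by rwa [dist_comm])
    rw [eventually_nhdsWithin_iff] at hx0
    obtain ⟨ρ, hρ, h⟩ := Metric.eventually_nhds_iff.1 hx0
    refine ⟨min (ρ / 2) (1 / 4), by positivity, min_le_right _ _, fun x hx hxc => ?_⟩
    by_contra! hlt
    refine absurd (h (y := x) ?_ hx) hxc.not_gt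
    rw [dist_zero_right]
    linarith [min_le_left (ρ / 2) (1 / 4)]
  obtain ⟨G₁, hG₁, hG₁G, -⟩ := G.continuous.exists_contDiff_approx 1
    (continuous_const (y := η)) (fun _ => hη)
  obtain ⟨v, hvη, hv⟩ : ∃ v, ‖v‖ < η ∧ v ∉ G₁ '' sphere c δ := by
    have hnull : μ (G₁ '' sphere c δ) = 0 :=
      addHaar_image_eq_zero_of_differentiableOn_of_addHaar_eq_zero μ
        (hG₁.differentiable one_ne_zero).differentiableOn
        (Measure.addHaar_sphere_of_ne_zero μ c hδ.ne')
    by_contra! h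
    have : μ (ball 0 η) ≤ 0 := hnull ▸ measure_mono fun v hv => h v (mem_ball_zero_iff.1 hv)
    exact absurd this (measure_ball_pos μ 0 hη).not_ge
  let Φ : E → E := fun y => c + max 1 (δ / dist y c) • (y - c)
  have hΦfar : ∀ y, δ ≤ dist y c → Φ y = y := by
    intro y hy
    simp only [Φ]
    rw [max_eq_left ((div_le_one (hδ.trans_le hy)).2 hy)]
    simp
  have hΦnear : ∀ y, y ≠ c → dist y c < δ → dist (Φ y) c = δ := by
    intro y hyc hy
    have hpos := dist_pos.2 hyc
    simp only [Φ]
    rw [max_eq_right ((one_le_div hpos).2 hy.le), dist_eq_norm, add_sub_cancel_left, norm_smul,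
      ← dist_eq_norm, norm_div, Real.norm_of_nonneg hδ.le, Real.norm_of_nonneg hpos.le,
      div_mul_cancel₀ _ hpos.ne']
  have hfc : ∀ x ∈ closedBall (0 : E) 1, f x ≠ c := fun x hx h => hcK ⟨x, hx, h⟩
  have hΦf : ContinuousOn (fun x => Φ (f x)) (closedBall 0 1) := by
    refine continuousOn_const.add (ContinuousOn.smul (continuousOn_const.sup ?_)
      (hf.sub continuousOn_const))
    exact continuousOn_const.div (fun x hx => Filter.Tendsto.dist (hf x hx) tendsto_const_nhds)
      fun x hx => (dist_pos.2 (hfc x hx)).ne'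
  have hG₁G' : ∀ y, ‖G₁ y - v - G y‖ < 2 * η := by
    intro y
    have h1 := hG₁G y
    rw [dist_eq_norm] at h1
    calc ‖G₁ y - v - G y‖ = ‖(G₁ y - G y) - v‖ := by congr 1; abel
      _ ≤ ‖G₁ y - G y‖ + ‖v‖ := norm_sub_le _ _
      _ < 2 * η := by linarith
  obtain ⟨x, hx, hx0⟩ := exists_zero_of_norm_sub_le_one
    (F := fun x => G₁ (Φ (f x)) - v)
    ((hG₁.continuous.comp_continuousOn hΦf).sub continuousOn_const) (by
      intro x hx
      have hxG := hG x hx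
      rcases le_or_gt δ (dist (f x) c) with h | h
      · have h1 := hG₁G' (f x)
        simp only [hΦfar _ h]
        rw [hxG] at h1
        linarith
      · have h1 := hG₁G' (Φ (f x))
        have h2 := hGδ (Φ (f x)) (by
          have := hΦnear _ (hfc x hx) h
          linarith [dist_triangle (Φ (f x)) c (f 0)])
        have h3 := hGδ (f x) (by linarith [dist_triangle (f x) c (f 0)])
        rw [hxG] at h3
        calc ‖G₁ (Φ (f x)) - v - x‖
            = ‖(G₁ (Φ (f x)) - v - G (Φ (f x))) + G (Φ (f x)) - x‖ := by congr 1; abel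
          _ ≤ ‖(G₁ (Φ (f x)) - v - G (Φ (f x)))‖ + ‖G (Φ (f x))‖ + ‖x‖ :=
            (norm_sub_le _ _).trans (by gcongr; exact norm_add_le _ _)
          _ ≤ 1 := by linarith)
  rcases le_or_gt δ (dist (f x) c) with h | h
  · have h1 := hG₁G' (f x)
    simp only [hΦfar _ h] at hx0
    rw [hx0, hG x hx, zero_sub, norm_neg] at h1
    linarith [hGη x hx h]
  · exact hv ⟨_, hΦnear _ (hfc x hx) h, sub_eq_zero.1 hx0⟩

open Set Metric in
theorem isOpen_image_of_continuousOn_of_injOn {E : Type*} [NormedAddCommGroup E]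
    [InnerProductSpace ℝ E] [FiniteDimensional ℝ E] {f : E → E} {V : Set E} (hV : IsOpen V)
    (hf : ContinuousOn f V) (hinj : InjOn f V) : IsOpen (f '' V) := by
  rw [isOpen_iff_mem_nhds]
  rintro _ ⟨x, hx, rfl⟩
  obtain ⟨ρ, hρ, hsub⟩ := nhds_basis_closedBall.mem_iff.1 (hV.mem_nhds hx)
  have hmaps : MapsTo (fun y : E => x + ρ • y) (closedBall 0 1) V := by
    intro y hy
    refine hsub ?_
    rw [mem_closedBall_zero_iff] at hy
    rw [mem_closedBall, dist_self_add_left, norm_smul, Real.norm_of_nonneg hρ.le]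
    nlinarith
  have h := image_closedBall_mem_nhds_of_injOn (f := fun y => f (x + ρ • y))
    (hf.comp (by fun_prop) hmaps)
    (fun y hy z hz hyz => by
      have := hinj (hmaps hy) (hmaps hz) hyz
      exact smul_right_injective E hρ.ne' (add_left_cancel this))
  simp only [smul_zero, add_zero] at h
  refine Filter.mem_of_superset h ?_
  rintro _ ⟨y, hy, rfl⟩
  exact ⟨_, hmaps hy, rfl⟩

theorem neg_inner_le_of_norm_sub_le {E : Type*} [NormedAddCommGroup E] [InnerProductSpace ℝ E]
    {e w : E} {ε : ℝ} (he : ‖e‖ = 1) (hε0 : 0 ≤ ε) (hε : ε ≤ 1 / 20) (hw : ‖w‖ ≤ 2.35)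
    (hwe : ‖w - e‖ ≤ (1 + ε) * ‖w + e‖) : -⟪w, e⟫ ≤ 3.4 * ε := by
  rcases le_or_gt 0 ⟪w, e⟫ with h | h
  · linarith
  have h1 : ‖w - e‖ ^ 2 ≤ (1 + ε) ^ 2 * ‖w + e‖ ^ 2 := by
    rw [← mul_pow]; gcongr
  rw [norm_sub_sq_real, norm_add_sq_real, he] at h1
  have h2 : ‖w‖ ^ 2 ≤ 2.35 ^ 2 := by gcongr
  have h3 : -4 * ⟪w, e⟫ ≤ (ε * (2 + ε)) * (1 + ‖w‖ ^ 2) := by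
    nlinarith [mul_nonneg hε0 (by linarith : 0 ≤ 2 + ε)]
  have h4 : ε * (2 + ε) ≤ 2.05 * ε := by nlinarith
  nlinarith [sq_nonneg ‖w‖]

open Set Metric in
theorem ball_subset_image_ball_of_weakly_quasisymmetric {E : Type*} [NormedAddCommGroup E]
    [InnerProductSpace ℝ E] [FiniteDimensional ℝ E] {U : Set E} {f : E → E} {e : E} {ε : ℝ}
    (hball : closedBall 0 1 ⊆ U) (hf : ContinuousOn f U) (hinj : InjOn f U)
    (hε : ε ≤ 1 / 20) (he : ‖e‖ = 1)
    (hqs : ∀ a ∈ U, ∀ b ∈ U, ∀ c ∈ U,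
      dist a b ≤ dist a c → dist (f a) (f b) ≤ (1 + ε) * dist (f a) (f c))
    (hf1 : f e = e) (hf2 : f (-e) = -e) : ball (f 0) (5 / 6) ⊆ f '' ball 0 1 := by
  have h0 : (0 : E) ∈ U := hball (by simp)
  refine subset_image_ball_of_disjoint_image_sphere (hf.mono hball)
    (isOpen_image_of_continuousOn_of_injOn isOpen_ball (hf.mono (ball_subset_closedBall.trans hball))
      (hinj.mono (ball_subset_closedBall.trans hball)))
    (convex_ball _ _).isPreconnected ⟨f 0, by simp, 0, by simp, rfl⟩ ?_
  rw [disjoint_left]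
  rintro _ hy ⟨x, hx, rfl⟩
  rw [mem_sphere_zero_iff_norm] at hx
  rw [mem_ball, dist_comm] at hy
  have hxU : x ∈ U := hball (by simp [hx])
  have h1 := hqs 0 h0 e (hball (by simp [he])) x hxU (by simp [he, hx])
  have h2 := hqs 0 h0 (-e) (hball (by simp [he])) x hxU (by simp [he, hx])
  rw [hf1] at h1
  rw [hf2] at h2
  have h3 : dist e (-e) = 2 := by
    rw [dist_eq_norm, sub_neg_eq_add, ← two_smul ℝ, norm_smul, he]; norm_num
  have h4 := dist_triangle_left e (-e) (f 0)
  have h5 : (1 + ε) * dist (f 0) (f x) ≤ (1 + 1 / 20) * (5 / 6) := by gcongr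
  linarith

theorem norm_map_zero_le_of_weakly_quasisymmetric {E : Type*} [NormedAddCommGroup E]
    [InnerProductSpace ℝ E] {U : Set E} {f : E → E} {e : E} {ε : ℝ}
    (hball : Metric.closedBall 0 1 ⊆ U) (hε : ε ≤ 1 / 20) (he : ‖e‖ = 1)
    (hqs : ∀ a ∈ U, ∀ b ∈ U, ∀ c ∈ U,
      dist a b ≤ dist a c → dist (f a) (f b) ≤ (1 + ε) * dist (f a) (f c))
    (hf1 : f e = e) (hf2 : f (-e) = -e) : ‖f 0‖ ≤ 1.85 := by
  have h0 : (0 : E) ∈ U := hball (by simp)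
  have heU : e ∈ U := hball (by simp [he])
  have heU' : -e ∈ U := hball (by simp [he])
  have h3 : dist e (-e) = 2 := by
    rw [dist_eq_norm, sub_neg_eq_add, ← two_smul ℝ, norm_smul, he]; norm_num
  have h1 := hqs e heU 0 h0 (-e) heU' (by rw [h3]; simp [he])
  have h2 := hqs (-e) heU' 0 h0 e heU (by rw [dist_comm (-e) e, h3]; simp [he])
  rw [hf1, hf2, h3, dist_comm, dist_eq_norm] at h1
  rw [hf1, hf2, dist_comm (-e) e, h3, dist_comm, dist_eq_norm, sub_neg_eq_add] at h2
  have h4 : ‖f 0 - e‖ ^ 2 ≤ 2.1 ^ 2 := by gcongr; linarith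
  have h5 : ‖f 0 + e‖ ^ 2 ≤ 2.1 ^ 2 := by gcongr; linarith
  rw [norm_sub_sq_real, he] at h4
  rw [norm_add_sq_real, he] at h5
  nlinarith [norm_nonneg (f 0)]

open Set Metric in
theorem neg_inner_map_le_of_weakly_quasisymmetric {E : Type*} [NormedAddCommGroup E]
    [InnerProductSpace ℝ E] {U : Set E} {f : E → E} {e : E} {ε : ℝ}
    (hball : closedBall 0 1 ⊆ U) (hε0 : 0 ≤ ε) (hε : ε ≤ 1 / 20) (he : ‖e‖ = 1)
    (hqs : ∀ a ∈ U, ∀ b ∈ U, ∀ c ∈ U,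
      dist a b ≤ dist a c → dist (f a) (f b) ≤ (1 + ε) * dist (f a) (f c))
    (hf1 : f e = e) (hf2 : f (-e) = -e) {z : E} (hz : z ∈ U) (hfz : dist (f z) (f 0) ≤ 1 / 2)
    (hze : 0 ≤ ⟪z, e⟫) : -⟪f z, e⟫ ≤ 3.4 * ε := by
  have h0 := norm_map_zero_le_of_weakly_quasisymmetric hball hε he hqs hf1 hf2
  refine neg_inner_le_of_norm_sub_le he hε0 hε ?_ ?_
  · have : ‖f z‖ ≤ ‖f z - f 0‖ + ‖f 0‖ := by simpa using norm_add_le (f z - f 0) (f 0)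
    rw [dist_eq_norm] at hfz
    linarith
  · have h := hqs z hz e (hball (by simp [he])) (-e) (hball (by simp [he])) (by
      rw [dist_eq_norm, dist_eq_norm, sub_neg_eq_add]
      refine le_of_sq_le_sq ?_ (norm_nonneg _)
      rw [norm_sub_sq_real, norm_add_sq_real]
      linarith)
    rwa [hf1, hf2, dist_eq_norm, dist_eq_norm, sub_neg_eq_add] at h

open Set Metric in
theorem exists_dist_le_of_weakly_quasisymmetric {E : Type*} [NormedAddCommGroup E]
    [InnerProductSpace ℝ E] [FiniteDimensional ℝ E] {U : Set E} {f : E → E} {e : E} {ε δ : ℝ}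
    (hball : closedBall 0 1 ⊆ U) (hf : ContinuousOn f U) (hinj : InjOn f U)
    (hε0 : 0 ≤ ε) (hε : ε ≤ 1 / 20) (he : ‖e‖ = 1)
    (hqs : ∀ a ∈ U, ∀ b ∈ U, ∀ c ∈ U,
      dist a b ≤ dist a c → dist (f a) (f b) ≤ (1 + ε) * dist (f a) (f c))
    (hf1 : f e = e) (hf2 : f (-e) = -e) (hδ0 : 0 < δ) (hδ : δ ≤ 1 / 20)
    {l : E} (hl : ‖l‖ ≤ 1 / 2) (hle : ⟪l, e⟫ = 0) :
    ∃ z ∈ U, ⟪z, e⟫ = 0 ∧ dist (f z) (f 0) ≤ 1 / 2 ∧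
      dist (f 0 + l) (f z) ≤ 10 * ε + 3 * δ := by
  obtain ⟨β, hβ⟩ : ∃ β, β = 3.4 * ε + δ := ⟨_, rfl⟩
  have hβ0 : 0 < β := by linarith
  have hβ4 : β ≤ 1 / 4 := by linarith
  obtain ⟨t, ht⟩ : ∃ t, t = √(1 - 16 * β ^ 2) := ⟨_, rfl⟩
  have ht2 : t ^ 2 = 1 - 16 * β ^ 2 := by rw [ht, Real.sq_sqrt]; nlinarith
  have htβ : 1 - 4 * β ≤ t := by rw [ht]; apply Real.le_sqrt_of_sq_le; nlinarith
  have ht1 : t ≤ 1 := by nlinarith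
  have hsubU : ball (0 : E) 1 ⊆ U := ball_subset_closedBall.trans hball
  have hl2 : ‖l‖ ^ 2 ≤ 1 / 4 := by nlinarith [norm_nonneg l]
  have hnorm : ∀ a s : ℝ, ‖a • l + s • e‖ ^ 2 = a ^ 2 * ‖l‖ ^ 2 + s ^ 2 := by
    intro a s
    rw [norm_add_sq_real, real_inner_smul_left, real_inner_smul_right, hle, norm_smul, norm_smul,
      he, mul_pow, mul_pow, Real.norm_eq_abs, Real.norm_eq_abs, sq_abs, sq_abs]
    ring
  let γ : ℝ → E := fun s => f 0 + (t • l + s • e)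
  have hγ : ∀ s ∈ Icc (-(2 * β)) (2 * β), dist (γ s) (f 0) ≤ 1 / 2 := by
    intro s hs
    rw [dist_eq_norm, add_sub_cancel_left]
    refine le_of_sq_le_sq ?_ (by norm_num)
    rw [hnorm, ht2]
    have : s ^ 2 ≤ (2 * β) ^ 2 := sq_le_sq' hs.1 hs.2
    nlinarith
  have hinner : ∀ s, ⟪γ s, e⟫ = ⟪f 0, e⟫ + s := by
    intro s
    simp only [γ]
    rw [inner_add_left, inner_add_left, real_inner_smul_left, real_inner_smul_left, hle,
      real_inner_self_eq_norm_sq, he]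
    ring
  have hlow : ∀ z ∈ U, dist (f z) (f 0) ≤ 1 / 2 → 0 ≤ ⟪z, e⟫ → -⟪f z, e⟫ ≤ 3.4 * ε :=
    fun z hz hfz => neg_inner_map_le_of_weakly_quasisymmetric hball hε0 hε he hqs hf1 hf2 hz hfz
  have hupp : ∀ z ∈ U, dist (f z) (f 0) ≤ 1 / 2 → ⟪z, e⟫ ≤ 0 → ⟪f z, e⟫ ≤ 3.4 * ε := by
    intro z hz hfz hze
    simpa using neg_inner_map_le_of_weakly_quasisymmetric (e := -e) hball hε0 hε (by simpa) hqs
      hf2 (by simpa) hz hfz (by simpa)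
  have h0U : (0 : E) ∈ U := hball (by simp)
  have hlow0 := hlow 0 h0U (by simp) (by simp)
  have hupp0 := hupp 0 h0U (by simp) (by simp)
  have hpre : ∀ s ∈ Icc (-(2 * β)) (2 * β), ∃ z ∈ ball (0 : E) 1, f z = γ s := fun s hs =>
    ball_subset_image_ball_of_weakly_quasisymmetric hball hf hinj hε he hqs hf1 hf2
      (mem_ball.2 ((hγ s hs).trans_lt (by norm_num)))
  obtain ⟨z, hz, hze, s, hs, hzs⟩ : ∃ z ∈ ball (0 : E) 1, ⟪z, e⟫ = 0 ∧
      ∃ s ∈ Icc (-(2 * β)) (2 * β), f z = γ s := by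
    by_contra! hno
    have hopen : ∀ W : Set E, IsOpen W → IsOpen (f '' (ball 0 1 ∩ W)) := fun W hW =>
      isOpen_image_of_continuousOn_of_injOn (isOpen_ball.inter hW)
        (hf.mono (inter_subset_left.trans hsubU)) (hinj.mono (inter_subset_left.trans hsubU))
    have hconn : IsPreconnected (γ '' Icc (-(2 * β)) (2 * β)) :=
      isPreconnected_Icc.image γ (by fun_prop)
    obtain ⟨_, -, ⟨z₁, hz₁, rfl⟩, z₂, hz₂, h12⟩ := hconn
      (f '' (ball 0 1 ∩ {z | 0 < ⟪z, e⟫})) (f '' (ball 0 1 ∩ {z | ⟪z, e⟫ < 0}))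
      (hopen _ (isOpen_lt (by fun_prop) (by fun_prop)))
      (hopen _ (isOpen_lt (by fun_prop) (by fun_prop)))
      (by
        rintro _ ⟨s, hs, rfl⟩
        obtain ⟨z, hz, hzs⟩ := hpre s hs
        rcases lt_trichotomy 0 ⟪z, e⟫ with h | h | h
        · exact .inl ⟨z, ⟨hz, h⟩, hzs⟩
        · exact absurd hzs (hno z hz h.symm s hs)
        · exact .inr ⟨z, ⟨hz, h⟩, hzs⟩)
      (by
        have hs : 2 * β ∈ Icc (-(2 * β)) (2 * β) := ⟨by linarith, le_rfl⟩
        obtain ⟨z, hz, hzs⟩ := hpre _ hs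
        refine ⟨_, ⟨_, hs, rfl⟩, z, ⟨hz, ?_⟩, hzs⟩
        by_contra h
        have := hupp z (hsubU hz) (hzs ▸ hγ _ hs) (not_lt.1 h)
        rw [hzs, hinner] at this
        linarith)
      (by
        have hs : -(2 * β) ∈ Icc (-(2 * β)) (2 * β) := ⟨le_rfl, by linarith⟩
        obtain ⟨z, hz, hzs⟩ := hpre _ hs
        refine ⟨_, ⟨_, hs, rfl⟩, z, ⟨hz, ?_⟩, hzs⟩
        by_contra h
        have := hlow z (hsubU hz) (hzs ▸ hγ _ hs) (not_lt.1 h)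
        rw [hzs, hinner] at this
        linarith)
    have heq := hinj (hsubU hz₁.1) (hsubU hz₂.1) h12.symm
    exact lt_asymm (show 0 < ⟪z₁, e⟫ from hz₁.2) (heq ▸ hz₂.2)
  refine ⟨z, hsubU hz, hze, hzs ▸ hγ s hs, ?_⟩
  have hdiff : f 0 + l - γ s = (1 - t) • l + (-s) • e := by
    simp only [γ]; module
  rw [hzs, dist_eq_norm, hdiff]
  refine le_of_sq_le_sq ?_ (by positivity)
  rw [hnorm]
  have h1 : s ^ 2 ≤ (2 * β) ^ 2 := sq_le_sq' hs.1 hs.2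
  have h2 : (1 - t) ^ 2 ≤ (4 * β) ^ 2 := by gcongr; linarith
  have h3 : (1 - t) ^ 2 * ‖l‖ ^ 2 ≤ (4 * β) ^ 2 * (1 / 4) := by gcongr
  have h4 : 8 * β ^ 2 ≤ (10 * ε + 3 * δ) ^ 2 := by
    rw [hβ]; nlinarith [mul_nonneg hε0 hδ0.le, sq_nonneg ε, sq_nonneg δ]
  nlinarith

/-- Lemma 2.3: if `f` is a weakly `(1+ε)`-quasisymmetric homeomorphism onto its image,
`0 ≤ ε ≤ 1/20`, on an open set `U` containing the closed unit ball, with `f(±e₁) = ±e₁`,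
then `f(B(0,1)) ⊇ B(f 0, 5/6)` and `θ_{f(L)}(f 0, 1/2) ≤ 20 ε`, where `L = e₁ᗮ`. -/
theorem flat_lemma {n : ℕ} (hn : 0 < n)
    (U : Set (EuclideanSpace ℝ (Fin n))) (hU : IsOpen U)
    (hball : Metric.closedBall (0 : EuclideanSpace ℝ (Fin n)) 1 ⊆ U)
    (f : EuclideanSpace ℝ (Fin n) → EuclideanSpace ℝ (Fin n))
    (hemb : Topology.IsEmbedding (fun x : U => f x))
    (ε : ℝ) (hε0 : 0 ≤ ε) (hε : ε ≤ 1/20)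
    (e₁ : EuclideanSpace ℝ (Fin n)) (he₁ : e₁ = EuclideanSpace.single ⟨0, hn⟩ 1)
    (hqs : ∀ a ∈ U, ∀ b ∈ U, ∀ c ∈ U,
      dist a b ≤ dist a c → dist (f a) (f b) ≤ (1 + ε) * dist (f a) (f c))
    (hf1 : f e₁ = e₁) (hf2 : f (-e₁) = -e₁) :
    Metric.ball (f 0) (5/6) ⊆ f '' (Metric.ball (0 : EuclideanSpace ℝ (Fin n)) 1) ∧
    localFlatness (f '' ({y : EuclideanSpace ℝ (Fin n) | ⟪y, e₁⟫ = 0} ∩ U)) (f 0) (1/2)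
      ≤ 20 * ε := by
  have he : ‖e₁‖ = 1 := by simp [he₁]
  have hf : ContinuousOn f U := continuousOn_iff_continuous_domRestrict.2 hemb.continuous
  have hinj : Set.InjOn f U := Set.injOn_iff_injective.2 hemb.injective
  refine ⟨ball_subset_image_ball_of_weakly_quasisymmetric hball hf hinj hε he hqs hf1 hf2, ?_⟩
  have hlow : ∀ z ∈ U, dist (f z) (f 0) ≤ 1 / 2 → ⟪z, e₁⟫ = 0 → |⟪f z, e₁⟫| ≤ 3.4 * ε := by
    intro z hz hfz hze
    rw [abs_le']
    constructor
    · simpa using neg_inner_map_le_of_weakly_quasisymmetric (e := -e₁) hball hε0 hε (by simpa) hqs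
        hf2 (by simpa) hz hfz (by simp [hze])
    · exact neg_inner_map_le_of_weakly_quasisymmetric hball hε0 hε he hqs hf1 hf2 hz hfz hze.ge
  have h0 := hlow 0 (hball (by simp)) (by simp) (by simp)
  suffices h : Metric.hausdorffDist
      (f '' ({y | ⟪y, e₁⟫ = 0} ∩ U) ∩ Metric.closedBall (f 0) (1 / 2))
      ((f 0 +ᵥ (((ℝ ∙ e₁)ᗮ : Submodule ℝ (EuclideanSpace ℝ (Fin n))) :
        Set (EuclideanSpace ℝ (Fin n)))) ∩ Metric.closedBall (f 0) (1 / 2)) ≤ 10 * ε by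
    have hfin : Module.finrank ℝ (ℝ ∙ e₁)ᗮ = n - 1 := by
      have h1 := Submodule.finrank_add_finrank_orthogonal (ℝ ∙ e₁)
      rw [finrank_span_singleton (norm_ne_zero_iff.1 (he ▸ one_ne_zero)),
        finrank_euclideanSpace_fin] at h1
      omega
    have hdouble : ∀ x : ℝ, x ≤ 10 * ε → 1 / (1 / 2) * x ≤ 20 * ε := fun x hx => by linarith
    refine hdouble _ (le_trans (csInf_le ⟨0, ?_⟩ ⟨(ℝ ∙ e₁)ᗮ, hfin, rfl⟩) h)
    rintro _ ⟨L, -, rfl⟩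
    exact Metric.hausdorffDist_nonneg
  refine le_of_forall_pos_le_add fun η hη => ?_
  obtain ⟨δ, hδ0, hδ, hδη⟩ : ∃ δ : ℝ, 0 < δ ∧ δ ≤ 1 / 20 ∧ 3 * δ ≤ η :=
    ⟨min (1 / 20) (η / 3), by positivity, min_le_left _ _, by
      linarith [min_le_right (1 / 20) (η / 3)]⟩
  refine Metric.hausdorffDist_le_of_mem_dist (by positivity) ?_ ?_
  · rintro _ ⟨⟨z, ⟨hze, hzU⟩, rfl⟩, hz⟩
    have hw := hlow z hzU hz hze
    have hproj : ⟪f z - f 0 - ⟪f z - f 0, e₁⟫ • e₁, e₁⟫ = 0 := by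
      rw [inner_sub_left, real_inner_smul_left, real_inner_self_eq_norm_sq, he]
      ring
    refine ⟨f 0 + (f z - f 0 - ⟪f z - f 0, e₁⟫ • e₁), ⟨⟨_,
      Submodule.mem_orthogonal_singleton_iff_inner_left.2 hproj, rfl⟩, ?_⟩, ?_⟩
    · rw [mem_closedBall_iff_norm] at hz ⊢
      rw [add_sub_cancel_left]
      refine le_trans (le_of_sq_le_sq ?_ (norm_nonneg _)) hz
      rw [norm_sub_sq_real, real_inner_smul_right, norm_smul, he, mul_one, Real.norm_eq_abs,
        sq_abs]
      nlinarith [sq_nonneg ⟪f z - f 0, e₁⟫]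
    · rw [dist_eq_norm, show f z - (f 0 + (f z - f 0 - ⟪f z - f 0, e₁⟫ • e₁)) =
        ⟪f z - f 0, e₁⟫ • e₁ by abel, norm_smul, he, mul_one, Real.norm_eq_abs, inner_sub_left]
      linarith [abs_sub ⟪f z, e₁⟫ ⟪f 0, e₁⟫]
  · rintro _ ⟨⟨l, hl, rfl⟩, hlball⟩
    have hl' : ‖l‖ ≤ 1 / 2 := by simpa using hlball
    obtain ⟨z, hzU, hze, hz, hd⟩ := exists_dist_le_of_weakly_quasisymmetric hball hf hinj hε0 hε he
      hqs hf1 hf2 hδ0 hδ hl' (Submodule.mem_orthogonal_singleton_iff_inner_left.1 hl)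
    exact ⟨f z, ⟨⟨z, ⟨hze, hzU⟩, rfl⟩, hz⟩, hd.trans (by linarith)⟩
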